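/- Let σ : ℝ → ℝ be sigmoidal, let d ∈ ℕ, let K ⊆ ℝ^d be a compact subset, let f : ℝ^d → ℝ be continuous, and let ε > 0. Then there exist m ∈ ℕ, coefficients α₁, …, α_m ∈ ℝ, vectors w₁, …, w_m ∈ ℝ^d and biases b₁, …, b_m ∈ ℝ such that for all x ∈ K, |Σ_{j=1}^m α_j · σ(⟨w_j, x⟩ + b_j) − f(x)| < ε, where ⟨·,·⟩ is the Euclidean inner product. -/

import Mathlib

open Filter RealInnerProductSpace

lemma sigmoid_bounded (σ : ℝ → ℝ) (hσ_cont : Continuous σ)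
    (hσ_top : Tendsto σ atTop (nhds 1)) (hσ_bot : Tendsto σ atBot (nhds 0)) :
    ∃ B : ℝ, 0 < B ∧ ∀ t, |σ t| ≤ B := by
  obtain ⟨T1, h1⟩ := eventually_atTop.1 (Metric.tendsto_nhds.1 hσ_top 1 one_pos)
  obtain ⟨T2, h2⟩ := eventually_atBot.1 (Metric.tendsto_nhds.1 hσ_bot 1 one_pos)
  obtain ⟨C, hC⟩ := (isCompact_Icc (a := T2) (b := T1)).exists_bound_of_continuousOn
    hσ_cont.continuousOn
  refine ⟨max C 2, by positivity, fun t => ?_⟩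
  by_cases ht1 : T1 ≤ t
  · have := h1 t ht1
    rw [Real.dist_eq, abs_lt] at this
    refine le_max_of_le_right ?_
    rw [abs_le]; constructor <;> linarith
  by_cases ht2 : t ≤ T2
  · have := h2 t ht2
    rw [Real.dist_eq, abs_lt] at this
    refine le_max_of_le_right ?_
    rw [abs_le]; constructor <;> linarith
  · exact le_max_of_le_left (hC t ⟨by linarith, by linarith⟩)

lemma sigmoid_scale (σ : ℝ → ℝ)
    (hσ_top : Tendsto σ atTop (nhds 1)) (hσ_bot : Tendsto σ atBot (nhds 0))
    (η : ℝ) (hη : 0 < η) :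
    ∃ A : ℝ, 0 < A ∧ (∀ s, 1 / 2 ≤ s → |σ (A * s) - 1| ≤ η) ∧
      (∀ s, s ≤ -(1 / 2) → |σ (A * s)| ≤ η) := by
  obtain ⟨T1, h1⟩ := eventually_atTop.1 (Metric.tendsto_nhds.1 hσ_top η hη)
  obtain ⟨T2, h2⟩ := eventually_atBot.1 (Metric.tendsto_nhds.1 hσ_bot η hη)
  refine ⟨2 * (|T1| + |T2| + 1), by positivity, fun s hs => ?_, fun s hs => ?_⟩
  · have := h1 (2 * (|T1| + |T2| + 1) * s) (by
      nlinarith [le_abs_self T1, abs_nonneg T1, abs_nonneg T2])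
    rw [Real.dist_eq] at this
    exact this.le
  · have := h2 (2 * (|T1| + |T2| + 1) * s) (by
      nlinarith [neg_abs_le T2, abs_nonneg T1, abs_nonneg T2])
    rw [Real.dist_eq, sub_zero] at this
    exact this.le

lemma one_dim (σ : ℝ → ℝ) (hσ_cont : Continuous σ)
    (hσ_top : Tendsto σ atTop (nhds 1)) (hσ_bot : Tendsto σ atBot (nhds 0))
    (g : ℝ → ℝ) (hg : Continuous g) (R : ℝ) (hR : 0 < R) (ε : ℝ) (hε : 0 < ε) :
    ∃ (N : ℕ) (c b : ℕ → ℝ) (a c0 : ℝ), ∀ t, |t| ≤ R →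
      |c0 + ∑ i ∈ Finset.range N, c i * σ (a * t + b i) - g t| ≤ ε := by
  obtain ⟨B, hB, hσB⟩ := sigmoid_bounded σ hσ_cont hσ_top hσ_bot
  set η := ε / (B + 3) with hηdef
  have hη : 0 < η := by positivity
  have huc := (isCompact_Icc (a := -R) (b := R)).uniformContinuousOn_of_continuous
    hg.continuousOn
  obtain ⟨δ, hδ, hgδ⟩ := Metric.uniformContinuousOn_iff.1 huc η hη
  obtain ⟨N, hN⟩ := exists_nat_gt (2 * R / δ)
  have hN0 : (0 : ℝ) < N := lt_trans (by positivity) hN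
  set h := 2 * R / N with hh
  have hhpos : 0 < h := by positivity
  have hhδ : h < δ := by
    rw [hh, div_lt_iff₀ hN0]; rw [div_lt_iff₀ hδ] at hN; linarith
  have hNh : N * h = 2 * R := by rw [hh]; field_simp
  obtain ⟨A, hA, hA1, hA2⟩ := sigmoid_scale σ hσ_top hσ_bot (1 / N) (by positivity)
  let p : ℕ → ℝ := fun i => -R + i * h
  have hp : ∀ i, i ≤ N → p i ∈ Set.Icc (-R) R := by
    intro i hi
    have : (i : ℝ) ≤ N := by exact_mod_cast hi
    have h1 : (i : ℝ) * h ≤ N * h := by gcongr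
    have h2 : 0 ≤ (i : ℝ) * h := by positivity
    exact ⟨by simp only [p]; linarith, by simp only [p]; linarith⟩
  have hstep : ∀ i, i < N → |g (p (i + 1)) - g (p i)| ≤ η := by
    intro i hi
    have := hgδ _ (hp (i + 1) hi) _ (hp i hi.le) (by
      rw [Real.dist_eq]
      have : p (i + 1) - p i = h := by simp only [p]; push_cast; ring
      rw [this, abs_of_pos hhpos]; exact hhδ)
    exact this.le
  refine ⟨N, fun i => g (p (i + 1)) - g (p i), fun i => A * (R / h - i - 1 / 2), A / h,
    g (p 0), fun t ht => ?_⟩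
  rw [abs_le] at ht
  set u := (t + R) / h with hu
  have hu0 : 0 ≤ u := div_nonneg (by linarith) hhpos.le
  have huh : u * h = t + R := by rw [hu]; field_simp
  set k := ⌊u⌋₊ with hk
  have hk1 : (k : ℝ) ≤ u := Nat.floor_le hu0
  have hk2 : u < k + 1 := Nat.lt_floor_add_one u
  have hkN : k ≤ N := by
    have : (k : ℝ) ≤ N := by
      refine hk1.trans ?_
      rw [hu, div_le_iff₀ hhpos]; linarith
    exact_mod_cast this
  have hlast : |g (p k) - g t| ≤ η := by
    have := hgδ _ (hp k hkN) t ⟨ht.1, ht.2⟩ (by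
      rw [Real.dist_eq, abs_lt]
      simp only [p]
      constructor <;> nlinarith)
    exact this.le
  have htel : ∑ i ∈ Finset.range N, (g (p (i + 1)) - g (p i)) * (if i < k then 1 else 0)
      = g (p k) - g (p 0) := by
    rw [← Finset.sum_range_sub (fun i => g (p i)) k]
    simp only [mul_ite, mul_one, mul_zero]
    rw [← Finset.sum_filter]
    congr 1
    ext i
    simp only [Finset.mem_filter, Finset.mem_range]
    omega
  have hterm : ∀ i ∈ Finset.range N,
      |(g (p (i + 1)) - g (p i)) * (σ (A / h * t + A * (R / h - i - 1 / 2))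
        - (if i < k then 1 else 0))| ≤ η * (1 / N) + (if i = k then η * B else 0) := by
    intro i hi
    have harg : A / h * t + A * (R / h - i - 1 / 2) = A * (u - i - 1 / 2) := by
      rw [hu]; field_simp; ring
    rw [harg, abs_mul]
    have hs := hstep i (Finset.mem_range.1 hi)
    rcases lt_trichotomy i k with hik | hik | hik
    · have : (i : ℝ) + 1 ≤ k := by exact_mod_cast hik
      rw [if_pos hik, if_neg hik.ne, add_zero]
      exact mul_le_mul hs (hA1 _ (by linarith)) (abs_nonneg _) hη.le
    · rw [if_neg (by omega), if_pos hik, sub_zero]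
      have h1 := mul_le_mul hs (hσB (A * (u - i - 1 / 2))) (abs_nonneg _) hη.le
      have : 0 ≤ η * (1 / N) := by positivity
      linarith
    · have : (k : ℝ) + 1 ≤ i := by exact_mod_cast hik
      rw [if_neg (by omega), if_neg hik.ne', add_zero, sub_zero]
      exact mul_le_mul hs (hA2 _ (by linarith)) (abs_nonneg _) hη.le
  have hsum := (Finset.abs_sum_le_sum_abs _ _).trans (Finset.sum_le_sum hterm)
  have hS2 : ∑ i ∈ Finset.range N, (η * (1 / N) + (if i = k then η * B else 0)) ≤ η + η * B := by
    rw [Finset.sum_add_distrib, Finset.sum_const, Finset.card_range, nsmul_eq_mul,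
      Finset.sum_ite_eq']
    have e : (N : ℝ) * (η * (1 / N)) = η := by field_simp
    rw [e]
    have : 0 ≤ η * B := by positivity
    split_ifs <;> linarith
  have hsum2 := hsum.trans hS2
  simp only [mul_sub] at hsum2
  simp only [Finset.sum_sub_distrib] at hsum2
  simp only [← mul_sub] at hsum2
  rw [htel] at hsum2
  have hεη : ε = η * (B + 3) := by rw [hηdef]; field_simp
  rw [abs_le] at hsum2 hlast ⊢
  constructor <;> linarith

/-- Cybenko's universal approximation theorem: for a sigmoidal `σ`, finite sums of ridge
functions `x ↦ α σ(⟨w, x⟩ + b)` uniformly approximate any continuous function on a compact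
subset of `ℝ^d`. -/
theorem cybenko_universal_approximation
    (σ : ℝ → ℝ) (hσ_cont : Continuous σ)
    (hσ_top : Tendsto σ atTop (nhds 1)) (hσ_bot : Tendsto σ atBot (nhds 0))
    (d : ℕ) (K : Set (EuclideanSpace ℝ (Fin d))) (hK : IsCompact K)
    (f : EuclideanSpace ℝ (Fin d) → ℝ) (hf : Continuous f) (ε : ℝ) (hε : 0 < ε) :
    ∃ (m : ℕ) (α : Fin m → ℝ) (w : Fin m → EuclideanSpace ℝ (Fin d)) (b : Fin m → ℝ),
      ∀ x ∈ K, |(∑ j : Fin m, α j * σ (⟪w j, x⟫ + b j)) - f x| < ε := by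
  haveI : CompactSpace K := isCompact_iff_compactSpace.1 hK
  let ridge : EuclideanSpace ℝ (Fin d) × ℝ → C(K, ℝ) := fun q =>
    ⟨fun x => σ (⟪q.1, (x : EuclideanSpace ℝ (Fin d))⟫ + q.2), by fun_prop⟩
  let S : Submodule ℝ C(K, ℝ) := Submodule.span ℝ (Set.range ridge)
  have hridge : ∀ q, ridge q ∈ S := fun q => Submodule.subset_span ⟨q, rfl⟩
  let ex : EuclideanSpace ℝ (Fin d) → C(K, ℝ) := fun w =>
    ⟨fun x => Real.exp ⟪w, (x : EuclideanSpace ℝ (Fin d))⟫, by fun_prop⟩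
  let M : Submonoid C(K, ℝ) :=
    { carrier := Set.range ex
      one_mem' := ⟨0, by ext x; simp [ex]⟩
      mul_mem' := by
        rintro _ _ ⟨w, rfl⟩ ⟨v, rfl⟩
        exact ⟨w + v, by ext x; simp [ex, inner_add_left, Real.exp_add]⟩ }
  have hconst : ∀ c : ℝ, ContinuousMap.const K c ∈ S := by
    intro c
    obtain ⟨T, hT⟩ := (hσ_top.eventually (lt_mem_nhds (show (0 : ℝ) < 1 from one_pos))).exists
    have : ContinuousMap.const K c = (c / σ T) • ridge (0, T) := by
      ext x
      simp [ridge, hT.ne']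
    rw [this]
    exact S.smul_mem _ (hridge _)
  have hexS : ∀ w, ex w ∈ S.topologicalClosure := by
    intro w
    change ex w ∈ closure (S : Set C(K, ℝ))
    rw [Metric.mem_closure_iff]
    intro e he
    obtain ⟨C, hC⟩ := hK.exists_bound_of_continuousOn
      (f := fun x : EuclideanSpace ℝ (Fin d) => (⟪w, x⟫ : ℝ)) (by fun_prop)
    obtain ⟨N, c, b, a, c0, happ⟩ := one_dim σ hσ_cont hσ_top hσ_bot Real.exp Real.continuous_exp
      (max C 1) (by positivity) (e / 2) (by positivity)
    refine ⟨ContinuousMap.const K c0 + ∑ i ∈ Finset.range N, c i • ridge (a • w, b i),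
      S.add_mem (hconst _) (S.sum_mem fun i _ => S.smul_mem _ (hridge _)), ?_⟩
    refine lt_of_le_of_lt ((ContinuousMap.dist_le (by positivity)).2 fun x => ?_) (half_lt_self he)
    rw [dist_comm, Real.dist_eq]
    have := happ ⟪w, (x : EuclideanSpace ℝ (Fin d))⟫ ((hC x x.2).trans (le_max_left _ _))
    simpa [ridge, ex, ContinuousMap.sum_apply, real_inner_smul_left] using this
  have hsep : (Algebra.adjoin ℝ (M : Set C(K, ℝ))).SeparatesPoints := by
    intro x y hxy
    refine ⟨ex ((x : EuclideanSpace ℝ (Fin d)) - y), ⟨_, Algebra.subset_adjoin ⟨_, rfl⟩, rfl⟩, ?_⟩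
    intro h
    have h2 := Real.exp_injective h
    have h3 : ⟪(x : EuclideanSpace ℝ (Fin d)) - y, (x : EuclideanSpace ℝ (Fin d)) - y⟫ = 0 := by
      rw [inner_sub_right]; exact sub_eq_zero.2 h2
    exact hxy (Subtype.ext (sub_eq_zero.1 (inner_self_eq_zero.1 h3)))
  have htop := ContinuousMap.subalgebra_topologicalClosure_eq_top_of_separatesPoints _ hsep
  have hle : (Algebra.adjoin ℝ (M : Set C(K, ℝ)) : Set C(K, ℝ)) ⊆ S.topologicalClosure := by
    intro F hF
    have hF' : F ∈ Subalgebra.toSubmodule (Algebra.adjoin ℝ (M : Set C(K, ℝ))) := hF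
    rw [Algebra.adjoin_eq_span, Submonoid.closure_eq] at hF'
    refine (Submodule.span_le.2 ?_) hF'
    rintro _ ⟨w, rfl⟩
    exact hexS w
  let F : C(K, ℝ) := ⟨fun x => f x, by fun_prop⟩
  have hF : F ∈ closure (S : Set C(K, ℝ)) := by
    have h1 : F ∈ (Algebra.adjoin ℝ (M : Set C(K, ℝ))).topologicalClosure := by
      rw [htop]; trivial
    exact closure_minimal hle S.isClosed_topologicalClosure h1
  obtain ⟨G, hG, hFG⟩ := Metric.mem_closure_iff.1 hF ε hε
  obtain ⟨m, α, q, hq⟩ := (Submodule.mem_span_set' (R := ℝ)).1 hG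
  choose r hr using fun j => (q j).2
  refine ⟨m, α, fun j => (r j).1, fun j => (r j).2, fun x hx => ?_⟩
  have hx1 := (ContinuousMap.dist_apply_le_dist (f := F) (g := G) ⟨x, hx⟩).trans_lt hFG
  rw [dist_comm, Real.dist_eq, ← hq] at hx1
  simp only [← hr] at hx1
  simpa [ridge, F, ContinuousMap.sum_apply] using hx1
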